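/- arXiv:2506.11355 — 2 statements merged into one kernel-verified Lean document; each statement's English description precedes it below -/
import Mathlib

section
/- There exists n₀ such that for all n ≥ n₀ the following holds with N := ⌊2^{10^{-10}·n}⌋: the fraction of tuples C = (c¹, …, c^N) ∈ ({0,1,2,3}^n)^N for which the vector v_C := N^{−1/2}·Σ_{s=1}^N ψ_{c^s} satisfies 1 − 2^{−n/10} ≤ ‖v_C‖² ≤ 1 + 2^{−n/10} is at least 0.9. (Equivalently, if each c^s is chosen independently and uniformly at random from {0,1,2,3}^n, then with probability at least 0.9 the stated norm bound holds.) -/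
open ComplexConjugate
open scoped Classical

/-- The four SIC-POVM qubit states. -/
noncomputable def chi : Fin 4 → Fin 2 → ℂ
  | 0 => ![1, 0]
  | 1 => ![(Real.sqrt 3 : ℂ)⁻¹, (Real.sqrt (2 / 3) : ℂ)]
  | 2 => ![(Real.sqrt 3 : ℂ)⁻¹,
      (Real.sqrt (2 / 3) : ℂ) * Complex.exp (2 * (Real.pi : ℂ) * Complex.I / 3)]
  | 3 => ![(Real.sqrt 3 : ℂ)⁻¹,
      (Real.sqrt (2 / 3) : ℂ) * Complex.exp (4 * (Real.pi : ℂ) * Complex.I / 3)]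

/-- The SIC product state ψ_c for c ∈ {0,1,2,3}^n. -/
noncomputable def sicProd (n : ℕ) (c : Fin n → Fin 4) : (Fin n → Fin 2) → ℂ :=
  fun x => ∏ i, chi (c i) (x i)

/-- ‖v_C‖² for v_C = N^{-1/2}·Σ_s ψ_{c^s}. -/
noncomputable def vCnormSq (n N : ℕ) (C : Fin N → Fin n → Fin 4) : ℝ :=
  ∑ x, ‖((Real.sqrt N : ℂ))⁻¹ * ∑ s, sicProd n (C s) x‖ ^ 2

/-- N = ⌊2^{10⁻¹⁰·n}⌋. -/
noncomputable def NN (n : ℕ) : ℕ := Nat.floor ((2 : ℝ) ^ ((10 : ℝ) ^ (-10 : ℝ) * n))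

/-- The inner product of two SIC-POVM qubit states. -/
noncomputable def chiInner (a b : Fin 4) : ℂ := ∑ k, conj (chi a k) * chi b k

/-- The inner product of two SIC product states. -/
noncomputable def sicInner (n : ℕ) (c d : Fin n → Fin 4) : ℂ :=
  ∑ x, conj (sicProd n c x) * sicProd n d x

lemma exp_two_pi_div_three :
    Complex.exp (2 * (Real.pi : ℂ) * Complex.I / 3) = ⟨-1 / 2, Real.sqrt 3 / 2⟩ := by
  have h : (2 * (Real.pi : ℂ) * Complex.I / 3) =
      ((Real.pi - Real.pi / 3 : ℝ) : ℂ) * Complex.I := by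
    push_cast; ring
  rw [h]
  apply Complex.ext
  · rw [Complex.exp_ofReal_mul_I_re, Real.cos_pi_sub, Real.cos_pi_div_three]; norm_num
  · rw [Complex.exp_ofReal_mul_I_im, Real.sin_pi_sub, Real.sin_pi_div_three]

lemma exp_four_pi_div_three :
    Complex.exp (4 * (Real.pi : ℂ) * Complex.I / 3) = ⟨-1 / 2, -(Real.sqrt 3 / 2)⟩ := by
  have h : (4 * (Real.pi : ℂ) * Complex.I / 3) =
      ((Real.pi / 3 + Real.pi : ℝ) : ℂ) * Complex.I := by
    push_cast; ring
  rw [h]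
  apply Complex.ext
  · rw [Complex.exp_ofReal_mul_I_re, Real.cos_add_pi, Real.cos_pi_div_three]; norm_num
  · rw [Complex.exp_ofReal_mul_I_im, Real.sin_add_pi, Real.sin_pi_div_three]

lemma chiInner_self (a : Fin 4) : chiInner a a = 1 := by
  have h3 : (Real.sqrt 3)⁻¹ * (Real.sqrt 3)⁻¹ = 1 / 3 := by
    rw [← mul_inv, Real.mul_self_sqrt (by norm_num)]; norm_num
  have hs : Real.sqrt 3 * Real.sqrt 3 = 3 := Real.mul_self_sqrt (by norm_num)
  have h23 : Real.sqrt (2 / 3) * Real.sqrt (2 / 3) = 2 / 3 := Real.mul_self_sqrt (by norm_num)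
  unfold chiInner
  fin_cases a <;>
    simp only [chi, exp_two_pi_div_three, exp_four_pi_div_three, ← Complex.ofReal_inv,
      Fin.sum_univ_two] <;>
    apply Complex.ext <;>
    simp [-Complex.ofReal_inv] <;> grind

lemma normSq_chiInner_of_ne {a b : Fin 4} (hab : a ≠ b) :
    Complex.normSq (chiInner a b) = 1 / 3 := by
  have h3 : (Real.sqrt 3)⁻¹ * (Real.sqrt 3)⁻¹ = 1 / 3 := by
    rw [← mul_inv, Real.mul_self_sqrt (by norm_num)]; norm_num
  have hs : Real.sqrt 3 * Real.sqrt 3 = 3 := Real.mul_self_sqrt (by norm_num)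
  have h23 : Real.sqrt (2 / 3) * Real.sqrt (2 / 3) = 2 / 3 := Real.mul_self_sqrt (by norm_num)
  unfold chiInner
  fin_cases a <;> fin_cases b <;> first | exact absurd rfl hab | skip
  all_goals
    simp only [chi, exp_two_pi_div_three, exp_four_pi_div_three, ← Complex.ofReal_inv,
      Fin.sum_univ_two, Complex.normSq_apply]
    simp [-Complex.ofReal_inv]
    grind

lemma norm_chiInner_of_ne_le {a b : Fin 4} (hab : a ≠ b) : ‖chiInner a b‖ ≤ 0.578 := by
  have h : ‖chiInner a b‖ ^ 2 = 1 / 3 := by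
    rw [← Complex.normSq_eq_norm_sq, normSq_chiInner_of_ne hab]
  nlinarith [norm_nonneg (chiInner a b)]

lemma sum_norm_chiInner_le (a : Fin 4) : ∑ b, ‖chiInner a b‖ ≤ 2.734 := by
  rw [← Finset.add_sum_erase _ _ (Finset.mem_univ a), chiInner_self]
  have h : ∑ b ∈ Finset.univ.erase a, ‖chiInner a b‖ ≤
      (Finset.univ.erase a).card • (0.578 : ℝ) :=
    Finset.sum_le_card_nsmul _ _ _ fun b hb =>
      norm_chiInner_of_ne_le (Finset.ne_of_mem_erase hb).symm
  rw [Finset.card_erase_of_mem (Finset.mem_univ a)] at h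
  norm_num at h ⊢
  linarith

lemma sicInner_eq_prod (n : ℕ) (c d : Fin n → Fin 4) :
    sicInner n c d = ∏ i, chiInner (c i) (d i) := by
  simp only [sicInner, sicProd, chiInner, map_prod, ← Finset.prod_mul_distrib,
    Finset.prod_univ_sum, Fintype.piFinset_univ]

lemma sicInner_self (n : ℕ) (c : Fin n → Fin 4) : sicInner n c c = 1 := by
  simp [sicInner_eq_prod, chiInner_self]

lemma sum_norm_sicInner_le (n : ℕ) (c : Fin n → Fin 4) :
    ∑ d, ‖sicInner n c d‖ ≤ 2.734 ^ n := by
  have h : ∑ d, ‖sicInner n c d‖ = ∏ i, ∑ b, ‖chiInner (c i) b‖ := by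
    simp only [sicInner_eq_prod, norm_prod, Finset.prod_univ_sum, Fintype.piFinset_univ]
  rw [h]
  refine (Finset.prod_le_prod (fun i _ => Finset.sum_nonneg fun b _ => norm_nonneg _)
    fun i _ => sum_norm_chiInner_le (c i)).trans ?_
  simp

lemma vCnormSq_eq_sum_sicInner (n N : ℕ) (C : Fin N → Fin n → Fin 4) :
    (vCnormSq n N C : ℂ) = (N : ℂ)⁻¹ * ∑ s, ∑ t, sicInner n (C s) (C t) := by
  have hN : ((Real.sqrt N : ℂ))⁻¹ * ((Real.sqrt N : ℂ))⁻¹ = (N : ℂ)⁻¹ := by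
    rw [← mul_inv, ← Complex.ofReal_mul, Real.mul_self_sqrt (Nat.cast_nonneg N)]
    simp
  have hx : ∀ x, ((‖((Real.sqrt N : ℂ))⁻¹ * ∑ s, sicProd n (C s) x‖ ^ 2 : ℝ) : ℂ) =
      (N : ℂ)⁻¹ * ∑ s, ∑ t, conj (sicProd n (C s) x) * sicProd n (C t) x := by
    intro x
    rw [Complex.ofReal_pow, ← Complex.conj_mul', map_mul, map_inv₀, Complex.conj_ofReal,
      map_sum, mul_mul_mul_comm, hN, Finset.sum_mul_sum]
  rw [vCnormSq, Complex.ofReal_sum, Finset.sum_congr rfl fun x _ => hx x, ← Finset.mul_sum,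
    Finset.sum_comm]
  congr 1
  refine Finset.sum_congr rfl fun s _ => ?_
  rw [Finset.sum_comm]
  rfl

lemma abs_vCnormSq_sub_one_le (n N : ℕ) (hN : N ≠ 0) (C : Fin N → Fin n → Fin 4) :
    |vCnormSq n N C - 1| ≤
      (N : ℝ)⁻¹ * ∑ s, ∑ t ∈ Finset.univ.erase s, ‖sicInner n (C s) (C t)‖ := by
  have h : ((vCnormSq n N C - 1 : ℝ) : ℂ) =
      (N : ℂ)⁻¹ * ∑ s, ∑ t ∈ Finset.univ.erase s, sicInner n (C s) (C t) := by
    have hs : ∀ s, ∑ t, sicInner n (C s) (C t) =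
        1 + ∑ t ∈ Finset.univ.erase s, sicInner n (C s) (C t) := fun s => by
      rw [← Finset.add_sum_erase _ _ (Finset.mem_univ s), sicInner_self]
    have hN' : (N : ℂ) ≠ 0 := Nat.cast_ne_zero.mpr hN
    push_cast
    rw [vCnormSq_eq_sum_sicInner, Finset.sum_congr rfl fun s _ => hs s,
      Finset.sum_add_distrib, mul_add]
    simp [hN']
  rw [← Real.norm_eq_abs, ← Complex.norm_real, h, norm_mul, norm_inv, Complex.norm_natCast]
  gcongr
  exact (norm_sum_le _ _).trans (Finset.sum_le_sum fun s _ => norm_sum_le _ _)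

/-- If every row of `f` sums to at most `b`, then the average of `f (C s) (C t)` over all tuples
`C` is at most `b` divided by the number of columns, for distinct `s` and `t`. -/
lemma card_mul_sum_pi_le {ι X : Type*} [Fintype ι] [DecidableEq ι] [Fintype X]
    (f : X → X → ℝ) (b : ℝ)
    (hf : ∀ x, ∑ y, f x y ≤ b) {s t : ι} (hst : s ≠ t) :
    (Fintype.card X : ℝ) * ∑ C : ι → X, f (C s) (C t) ≤ Fintype.card (ι → X) * b := by
  have h : ∑ C : ι → X, f (C s) (C t) =
      ∑ p : X × ({j // j ≠ t} → X), f (p.2 ⟨s, hst⟩) p.1 :=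
    Fintype.sum_equiv (Equiv.funSplitAt t X) _ _ fun C => by simp
  rw [h, Fintype.sum_prod_type_right, Fintype.card_congr (Equiv.funSplitAt t X),
    Fintype.card_prod, Nat.cast_mul, mul_assoc]
  gcongr
  refine (Finset.sum_le_sum fun p _ => hf (p ⟨s, hst⟩)).trans ?_
  simp

lemma sum_abs_vCnormSq_sub_one_le (n N : ℕ) (hN : N ≠ 0) :
    ∑ C : Fin N → Fin n → Fin 4, |vCnormSq n N C - 1| ≤
      Fintype.card (Fin N → Fin n → Fin 4) * (N * 0.6835 ^ n) := by
  set K : ℝ := (Fintype.card (Fin N → Fin n → Fin 4) : ℝ) with hK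
  have hK0 : 0 ≤ K := Nat.cast_nonneg _
  have hN0 : (0 : ℝ) < N := by positivity
  have hst : ∀ s t : Fin N, s ≠ t →
      ∑ C : Fin N → Fin n → Fin 4, ‖sicInner n (C s) (C t)‖ ≤ K * 0.6835 ^ n := by
    intro s t h
    have h1 := card_mul_sum_pi_le (fun c d => ‖sicInner n c d‖) _ (sum_norm_sicInner_le n) h
    have hc : (Fintype.card (Fin n → Fin 4) : ℝ) = 4 ^ n := by simp
    have hr : (2.734 : ℝ) ^ n = 4 ^ n * 0.6835 ^ n := by rw [← mul_pow]; norm_num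
    rw [← hK, hc, hr, mul_left_comm] at h1
    exact le_of_mul_le_mul_left h1 (by positivity)
  calc ∑ C : Fin N → Fin n → Fin 4, |vCnormSq n N C - 1|
      ≤ ∑ C : Fin N → Fin n → Fin 4,
          (N : ℝ)⁻¹ * ∑ s, ∑ t ∈ Finset.univ.erase s, ‖sicInner n (C s) (C t)‖ :=
        Finset.sum_le_sum fun C _ => abs_vCnormSq_sub_one_le n N hN C
    _ = (N : ℝ)⁻¹ * ∑ s, ∑ t ∈ Finset.univ.erase s,
          ∑ C : Fin N → Fin n → Fin 4, ‖sicInner n (C s) (C t)‖ := by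
        rw [← Finset.mul_sum, Finset.sum_comm]
        congr 1
        exact Finset.sum_congr rfl fun s _ => Finset.sum_comm
    _ ≤ (N : ℝ)⁻¹ * ∑ s : Fin N, ∑ t : Fin N, K * 0.6835 ^ n := by
        gcongr with s _
        refine (Finset.sum_le_sum fun t ht => hst s t (Finset.ne_of_mem_erase ht).symm).trans ?_
        exact Finset.sum_le_sum_of_subset_of_nonneg (Finset.erase_subset _ _)
          fun _ _ _ => by positivity
    _ = K * (N * 0.6835 ^ n) := by
        simp only [Finset.sum_const, Finset.card_univ, Fintype.card_fin, nsmul_eq_mul]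
        field_simp

/-- Markov's inequality for the counting measure on a finite type. -/
lemma sub_mul_card_le_card_filter_le {α : Type*} [Fintype α] (f : α → ℝ) (hf : ∀ a, 0 ≤ f a)
    {ε δ : ℝ} (hε : 0 < ε) (h : ∑ a, f a ≤ Fintype.card α * (δ * ε)) :
    (1 - δ) * (Fintype.card α : ℝ) ≤ ((Finset.univ.filter fun a => f a ≤ ε).card : ℝ) := by
  have h1 : ((Finset.univ.filter fun a => ¬ f a ≤ ε).card : ℝ) * ε ≤ ∑ a, f a := by
    rw [← nsmul_eq_mul]
    refine (Finset.card_nsmul_le_sum _ f ε fun a ha => ?_).trans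
      (Finset.sum_le_sum_of_subset_of_nonneg (Finset.filter_subset _ _) fun a _ _ => hf a)
    exact (not_le.mp (Finset.mem_filter.mp ha).2).le
  have h2 : ((Finset.univ.filter fun a => ¬ f a ≤ ε).card : ℝ) ≤ Fintype.card α * δ :=
    le_of_mul_le_mul_right (by linarith) hε
  have h3 : ((Finset.univ.filter fun a => f a ≤ ε).card : ℝ) +
      (Finset.univ.filter fun a => ¬ f a ≤ ε).card = Fintype.card α := by
    exact_mod_cast Finset.card_filter_add_card_filter_not (s := Finset.univ) fun a => f a ≤ ε
  linarith

lemma two_rpow_div_ten_le (n : ℕ) : (2 : ℝ) ^ ((n : ℝ) / 10) ≤ 1.08 ^ n := by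
  have h : (2 : ℝ) ^ ((1 : ℝ) / 10) ≤ 1.08 := by
    rw [one_div, Real.rpow_inv_le_iff_of_pos (by norm_num) (by norm_num) (by norm_num)]
    norm_num
  rw [show (n : ℝ) / 10 = 1 / 10 * n by ring, Real.rpow_mul_natCast (by norm_num)]
  gcongr

lemma NN_ne_zero (n : ℕ) : NN n ≠ 0 :=
  (Nat.floor_pos.mpr (Real.one_le_rpow (by norm_num) (by positivity))).ne'

lemma NN_le (n : ℕ) : (NN n : ℝ) ≤ 1.08 ^ n := by
  refine (Nat.floor_le (by positivity)).trans (le_trans ?_ (two_rpow_div_ten_le n))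
  refine Real.rpow_le_rpow_of_exponent_le (by norm_num) ?_
  have h : (10 : ℝ) ^ (-10 : ℝ) ≤ 10 ^ (-1 : ℝ) :=
    Real.rpow_le_rpow_of_exponent_le (by norm_num) (by norm_num)
  rw [Real.rpow_neg_one] at h
  rw [div_eq_inv_mul]
  gcongr

/-- for all large n, at least a 0.9 fraction of the tuples
C ∈ ({0,1,2,3}^n)^N (with N = ⌊2^{10⁻¹⁰·n}⌋) satisfy 1 − 2^{−n/10} ≤ ‖v_C‖² ≤ 1 + 2^{−n/10}. -/
theorem stmt_12 :
    ∃ n₀ : ℕ, ∀ n : ℕ, n₀ ≤ n →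
      (0.9 : ℝ) * (Fintype.card (Fin (NN n) → Fin n → Fin 4) : ℝ) ≤
        ((Finset.univ.filter fun C : Fin (NN n) → Fin n → Fin 4 =>
          1 - (2 : ℝ) ^ (-((n : ℝ) / 10)) ≤ vCnormSq n (NN n) C ∧
            vCnormSq n (NN n) C ≤ 1 + (2 : ℝ) ^ (-((n : ℝ) / 10))).card : ℝ) := by
  obtain ⟨n₀, h₀⟩ := Filter.eventually_atTop.mp
    ((tendsto_pow_atTop_nhds_zero_of_lt_one (r := (0.9 : ℝ)) (by norm_num)
      (by norm_num)).eventually_le_const (show (0 : ℝ) < 0.1 by norm_num))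
  refine ⟨n₀, fun n hn => ?_⟩
  have hε : (0 : ℝ) < 2 ^ (-((n : ℝ) / 10)) := by positivity
  have hsmall : (NN n : ℝ) * 0.6835 ^ n ≤ 0.1 * 2 ^ (-((n : ℝ) / 10)) := by
    rw [Real.rpow_neg (by norm_num), ← div_eq_mul_inv, le_div_iff₀ (by positivity)]
    calc (NN n : ℝ) * 0.6835 ^ n * 2 ^ ((n : ℝ) / 10)
        ≤ 1.08 ^ n * 0.6835 ^ n * 1.08 ^ n := by
          gcongr
          exacts [NN_le n, two_rpow_div_ten_le n]
      _ = (1.08 * 0.6835 * 1.08) ^ n := by rw [mul_pow, mul_pow]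
      _ ≤ 0.9 ^ n := by gcongr; norm_num
      _ ≤ 0.1 := h₀ n hn
  have h := sub_mul_card_le_card_filter_le
    (fun C : Fin (NN n) → Fin n → Fin 4 => |vCnormSq n (NN n) C - 1|)
    (fun _ => abs_nonneg _) hε
    ((sum_abs_vCnormSq_sub_one_le n (NN n) (NN_ne_zero n)).trans (by gcongr))
  refine le_trans (le_of_eq (by norm_num)) (h.trans (le_of_eq ?_))
  congr 2
  ext C
  simp only [Finset.mem_filter, Finset.mem_univ, true_and, abs_le]
  constructor <;> rintro ⟨h1, h2⟩ <;> constructor <;> linarith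
end

section
/- Let n ≥ 1, let (φ^i_0, φ^i_1) be an orthonormal basis of ℂ² for each i ∈ {1,…,n}, and let c, c' ∈ {0,1,2,3}^n. Let m be the number of indices i ∈ {1,…,n} such that |⟨φ^i_0, χ_{c_i}⟩|·|⟨χ_{c'_i}, φ^i_0⟩| + |⟨φ^i_1, χ_{c_i}⟩|·|⟨χ_{c'_i}, φ^i_1⟩| ≤ 0.99. Then Σ_{x ∈ {0,1}^n} ∏_{i=1}^n |⟨φ^i_{x_i}, χ_{c_i}⟩|·|⟨χ_{c'_i}, φ^i_{x_i}⟩| ≤ 0.99^m. (In particular, for the product basis φ_x := φ^1_{x_1} ⊗ ⋯ ⊗ φ^n_{x_n}, the quantity Σ_x |⟨φ_x, ψ_c⟩|·|⟨ψ_{c'}, φ_x⟩| is at most 0.99^m.) -/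
open ComplexConjugate
open scoped Classical

/-- Each SIC-POVM state is a unit vector. -/
theorem sum_norm_sq_chi (c : Fin 4) : ∑ j, ‖chi c j‖ ^ 2 = 1 := by
  have h₁ (t : ℝ) : ‖Complex.exp (t * Complex.I)‖ = 1 := Complex.norm_exp_ofReal_mul_I t
  have h₂ := h₁ (2 * Real.pi / 3)
  have h₄ := h₁ (4 * Real.pi / 3)
  push_cast [div_mul_eq_mul_div] at h₂ h₄
  fin_cases c <;>
    simp [chi, h₂, h₄, div_pow, abs_of_nonneg, Real.sqrt_nonneg] <;> norm_num

/-- Parseval's identity for an orthonormal basis of `ℂ^ι`, in coordinates. -/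
theorem sum_norm_sq_coord {ι : Type*} [Fintype ι] [DecidableEq ι] (φ : ι → ι → ℂ)
    (hφ : ∀ a b, ∑ j, conj (φ a j) * φ b j = if a = b then 1 else 0) (v : ι → ℂ) :
    ∑ k, ‖∑ j, conj (φ k j) * v j‖ ^ 2 = ∑ j, ‖v j‖ ^ 2 := by
  let A : Matrix ι ι ℂ := Matrix.of fun k j => conj (φ k j)
  have hA : A * A.conjTranspose = 1 := by
    ext a b
    simpa [A, Matrix.mul_apply, Matrix.one_apply] using hφ a b
  have hA' : A.conjTranspose * A = 1 := mul_eq_one_comm.mp hA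
  have norm_sq (w : ι → ℂ) : star w ⬝ᵥ w = ((∑ j, ‖w j‖ ^ 2 : ℝ) : ℂ) := by
    simp [dotProduct, Complex.conj_mul']
  have key : star (A.mulVec v) ⬝ᵥ A.mulVec v = star v ⬝ᵥ v := by
    rw [Matrix.star_mulVec, ← Matrix.dotProduct_mulVec, Matrix.mulVec_mulVec, hA',
      Matrix.one_mulVec]
  rw [norm_sq, norm_sq] at key
  exact_mod_cast key

/-- Cauchy–Schwarz for the coefficients of two unit vectors in an orthonormal basis. -/
theorem sum_norm_coord_mul_le_one {ι : Type*} [Fintype ι] [DecidableEq ι] (φ : ι → ι → ℂ)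
    (hφ : ∀ a b, ∑ j, conj (φ a j) * φ b j = if a = b then 1 else 0) (v w : ι → ℂ)
    (hv : ∑ j, ‖v j‖ ^ 2 = 1) (hw : ∑ j, ‖w j‖ ^ 2 = 1) :
    ∑ k, ‖∑ j, conj (φ k j) * v j‖ * ‖∑ j, conj (w j) * φ k j‖ ≤ 1 := by
  have swap (k : ι) : ‖∑ j, conj (w j) * φ k j‖ = ‖∑ j, conj (φ k j) * w j‖ := by
    rw [← Complex.norm_conj]
    simp [mul_comm]
  simp_rw [swap]
  refine (Real.sum_mul_le_sqrt_mul_sqrt _ _ _).trans ?_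
  rw [sum_norm_sq_coord φ hφ, sum_norm_sq_coord φ hφ, hv, hw]
  simp

/-- if m coordinates i satisfy the 0.99-contraction bound of the SIC
geometry in the single-qubit bases (φ^i_0, φ^i_1), then the full product sum
Σ_x ∏_i |⟨φ^i_{x_i},χ_{c_i}⟩|·|⟨χ_{c'_i},φ^i_{x_i}⟩| is at most 0.99^m. -/
theorem stmt_14 (n : ℕ) (hn : 1 ≤ n)
    (φ : Fin n → Fin 2 → Fin 2 → ℂ)
    (hortho : ∀ i a b, ∑ j, conj (φ i a j) * φ i b j = if a = b then 1 else 0)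
    (c c' : Fin n → Fin 4) :
    ∑ x : Fin n → Fin 2, ∏ i,
        (‖∑ j, conj (φ i (x i) j) * chi (c i) j‖ * ‖∑ j, conj (chi (c' i) j) * φ i (x i) j‖)
      ≤ (0.99 : ℝ) ^
        (Finset.univ.filter fun i : Fin n =>
          ‖∑ j, conj (φ i 0 j) * chi (c i) j‖ * ‖∑ j, conj (chi (c' i) j) * φ i 0 j‖
            + ‖∑ j, conj (φ i 1 j) * chi (c i) j‖ * ‖∑ j, conj (chi (c' i) j) * φ i 1 j‖
            ≤ 0.99).card := by
  rw [← Fintype.prod_sum (fun i k =>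
    ‖∑ j, conj (φ i k j) * chi (c i) j‖ * ‖∑ j, conj (chi (c' i) j) * φ i k j‖),
    ← Finset.prod_const, Finset.prod_filter]
  refine Finset.prod_le_prod (fun i _ => by positivity) fun i _ => ?_
  split_ifs with hi
  · rwa [Fin.sum_univ_two]
  · exact sum_norm_coord_mul_le_one (φ i) (hortho i) _ _ (sum_norm_sq_chi _) (sum_norm_sq_chi _)
end
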